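/- arXiv:2305.16281 — 2 statements merged into one kernel-verified Lean document; each statement's English description precedes it below -/
import Mathlib

section
/- Let k be a field, H a commutative Hopf algebra over k with comultiplication Δ : H → H ⊗_k H and antipode S : H → H, and let s be a finite subset of H. Then there exists a finitely generated k-subalgebra B of H containing s such that Δ maps B into the image of B ⊗_k B in H ⊗_k H (under the map induced by the inclusion B ⊆ H) and S maps B into B. Consequently, every commutative Hopf algebra over k is the directed union of its finitely generated Hopf subalgebras. -/
/-!
STATEMENT 6: In a commutative Hopf algebra H over a field k, every finite subset is contained
in a finitely generated Hopf subalgebra, i.e. a finitely generated subalgebra B with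
Δ(B) ⊆ im(B ⊗ B → H ⊗ H) and S(B) ⊆ B.
-/

open TensorProduct

universe u

open Coalgebra HopfAlgebra

section Slicing

variable {k : Type*} [Field k] {M N : Type*} [AddCommGroup M] [Module k M]
  [AddCommGroup N] [Module k N]

/-- The slice map `x ↦ g ↦ (id ⊗ g) x`. -/
noncomputable def sliceRight (k M N : Type*) [Field k] [AddCommGroup M] [Module k M]
    [AddCommGroup N] [Module k N] : M ⊗[k] N →ₗ[k] Module.Dual k N →ₗ[k] M :=
  (((LinearMap.lTensorHom M).compr₂ (TensorProduct.rid k M).toLinearMap :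
    Module.Dual k N →ₗ[k] M ⊗[k] N →ₗ[k] M)).flip

lemma sliceRight_apply (x : M ⊗[k] N) (g : Module.Dual k N) :
    sliceRight k M N x g = TensorProduct.rid k M (g.lTensor M x) := rfl

@[simp]
lemma sliceRight_tmul (m : M) (n : N) (g : Module.Dual k N) :
    sliceRight k M N (m ⊗ₜ n) g = g n • m := by
  simp [sliceRight_apply]

lemma sliceRight_injective : Function.Injective (sliceRight k M N) := by
  classical
  intro x y h
  let e := Module.Basis.ofVectorSpace k N
  apply (TensorProduct.equivFinsuppOfBasisRight e).injective
  have key (z : M ⊗[k] N) (i) :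
      TensorProduct.equivFinsuppOfBasisRight e z i = sliceRight k M N z (e.coord i) := by
    induction z with
    | zero => simp
    | tmul a b => simp
    | add a b ha hb => simp [ha, hb]
  ext i
  rw [key, key, h]

lemma finiteDimensional_range_sliceRight (x : M ⊗[k] N) :
    FiniteDimensional k (sliceRight k M N x).range := by
  induction x with
  | zero =>
    rw [map_zero, LinearMap.range_zero]
    infer_instance
  | tmul a b =>
    refine Submodule.finiteDimensional_of_le (S₂ := k ∙ a) ?_
    rintro _ ⟨g, rfl⟩
    exact Submodule.mem_span_singleton.2 ⟨g b, by simp⟩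
  | add x y hx hy =>
    refine Submodule.finiteDimensional_of_le
      (S₂ := (sliceRight k M N x).range ⊔ (sliceRight k M N y).range) ?_
    rintro _ ⟨g, rfl⟩
    rw [map_add, LinearMap.add_apply]
    exact Submodule.add_mem_sup ⟨g, rfl⟩ ⟨g, rfl⟩

lemma sliceRight_rTensor {P : Type*} [AddCommGroup P] [Module k P] (f : M →ₗ[k] P)
    (x : M ⊗[k] N) (g : Module.Dual k N) :
    sliceRight k P N (f.rTensor N x) g = f (sliceRight k M N x g) := by
  induction x with
  | zero => simp
  | tmul a b => simp
  | add a b ha hb => simp [ha, hb]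

end Slicing

section Coalgebra

variable {k : Type*} [Field k] {C : Type*} [AddCommGroup C] [Module k C] [Coalgebra k C]

lemma sliceRight_comul_counit (c : C) : sliceRight k C C (comul c) counit = c := by
  simp [sliceRight_apply]

lemma sliceRight_comul_sliceRight_comul (c : C) (g g' : Module.Dual k C) :
    sliceRight k C C (comul (sliceRight k C C (comul c) g)) g' =
      sliceRight k C C (comul c) (LinearMap.mul' k k ∘ₗ TensorProduct.map g' g ∘ₗ comul) := by
  have h₁ (x : C ⊗[k] C) : sliceRight k C C (comul (sliceRight k C C x g)) g' =
      sliceRight k C (C ⊗[k] C) (TensorProduct.assoc k C C C (comul.rTensor C x))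
        (LinearMap.mul' k k ∘ₗ TensorProduct.map g' g) := by
    induction x with
    | zero => simp
    | add a b ha hb => simp [ha, hb]
    | tmul a b =>
      rw [sliceRight_tmul, LinearMap.rTensor_tmul, map_smul, map_smul, LinearMap.smul_apply]
      induction (comul a : C ⊗[k] C) with
      | zero => simp
      | tmul u v => simp [smul_smul, mul_comm]
      | add u v hu hv => simp [TensorProduct.add_tmul, hu, hv]
  rw [h₁, coassoc_apply]
  simp only [sliceRight_apply, ← LinearMap.lTensor_comp_apply, LinearMap.comp_assoc]

/-- Every element of a coalgebra over a field is a linear combination of the entries of a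
multiplicative matrix. -/
theorem exists_multiplicative_matrix (c : C) :
    ∃ (n : ℕ) (a : Matrix (Fin n) (Fin n) C),
      (∀ i j, comul (R := k) (a i j) = ∑ l, a i l ⊗ₜ[k] a l j) ∧
      (∀ i j, counit (R := k) (a i j) = (1 : Matrix (Fin n) (Fin n) k) i j) ∧
      c ∈ Submodule.span k (Set.range fun p : Fin n × Fin n ↦ a p.1 p.2) := by
  set V := (sliceRight k C C (comul c)).range
  have : FiniteDimensional k V := finiteDimensional_range_sliceRight _
  let b := Module.finBasis k V
  obtain ⟨p, hp⟩ := V.subtype.exists_leftInverse_of_injective V.ker_subtype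
  have hpV (v : C) (hv : v ∈ V) : (p v : C) = v :=
    congrArg Subtype.val (LinearMap.congr_fun hp ⟨v, hv⟩)
  have hsum (x : C) : ∑ i, b.coord i (p x) • (b i : C) = p x := by
    simpa only [Submodule.coe_sum, Submodule.coe_smul, Module.Basis.coord_apply] using
      congrArg Subtype.val (b.sum_repr (p x))
  let f i : Module.Dual k C := b.coord i ∘ₗ p
  let F i : C ⊗[k] C →ₗ[k] C := TensorProduct.lid k C ∘ₗ (f i).rTensor C
  have hF (x : C ⊗[k] C) : ∑ i, (b i : C) ⊗ₜ[k] F i x = (V.subtype ∘ₗ p).rTensor C x := by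
    induction x with
    | zero => simp
    | tmul y z =>
      simp [F, f, TensorProduct.tmul_smul, ← TensorProduct.smul_tmul', ← hsum y,
        TensorProduct.sum_tmul]
    | add x y hx hy => simp [TensorProduct.tmul_add, Finset.sum_add_distrib, hx, hy]
  have hcomul (j) : ∑ i, (b i : C) ⊗ₜ[k] F i (comul (b j : C)) = comul (b j : C) := by
    rw [hF]
    apply sliceRight_injective
    ext g
    rw [sliceRight_rTensor]
    apply hpV
    obtain ⟨g', hg'⟩ := (b j).2
    rw [← hg', sliceRight_comul_sliceRight_comul]
    exact ⟨_, rfl⟩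
  have hcounitF (i) (x : C ⊗[k] C) : counit (R := k) (F i x) = f i (sliceRight k C C x counit) := by
    induction x with
    | zero => simp
    | tmul y z => simp [F, mul_comm]
    | add x y hx hy => simp [hx, hy]
  have hcomulF (i) (x : C ⊗[k] C) : comul (R := k) (F i x) =
      (F i).rTensor C ((TensorProduct.assoc k C C C).symm (comul.lTensor C x)) := by
    induction x with
    | zero => simp
    | add x y hx hy => simp [hx, hy]
    | tmul y z =>
      have (w : C ⊗[k] C) : f i y • w =
          (F i).rTensor C ((TensorProduct.assoc k C C C).symm (y ⊗ₜ w)) := by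
        induction w with
        | zero => simp
        | tmul u w => simp [F, TensorProduct.smul_tmul']
        | add u w hu hw => simp [TensorProduct.tmul_add, hu, hw]
      simp [← this, F]
  refine ⟨_, fun i j ↦ F i (comul (b j : C)), fun i j ↦ ?_, fun i j ↦ ?_, ?_⟩
  · rw [hcomulF, coassoc_symm_apply]
    nth_rw 1 [← hcomul j]
    simp
  · rw [hcounitF, sliceRight_comul_counit]
    have : p (b j : C) = b j := Subtype.ext (hpV _ (b j).2)
    simp [f, this, Matrix.one_apply, Finsupp.single_apply, eq_comm]
  · have hcV : c ∈ V := ⟨counit, sliceRight_comul_counit c⟩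
    rw [← hpV c hcV, ← hsum]
    refine Submodule.sum_mem _ fun j _ ↦ Submodule.smul_mem _ _ ?_
    have : ∑ i, counit (R := k) (b i : C) • F i (comul (b j : C)) = (b j : C) := by
      have := congrArg ((TensorProduct.lid k C).toLinearMap ∘ₗ counit.rTensor C) (hcomul j)
      simpa using this
    rw [← this]
    exact Submodule.sum_mem _ fun i _ ↦ Submodule.smul_mem _ _
      (Submodule.subset_span ⟨(i, j), rfl⟩)

end Coalgebra

section HopfAlgebra

variable {k : Type*} [Field k] {H : Type*} [CommRing H] [HopfAlgebra k H]

/-- A subalgebra closed under comultiplication and antipode; `B ⊗ B` is encoded as the subalgebra of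
`H ⊗ H` generated by `B ⊗ 1` and `1 ⊗ B`. -/
def IsHopfSubalgebra (B : Subalgebra k H) : Prop :=
  B ≤ (B.map Algebra.TensorProduct.includeLeft ⊔
    B.map (Algebra.TensorProduct.includeRight : H →ₐ[k] H ⊗[k] H)).comap
      (Bialgebra.comulAlgHom k H) ∧
  B ≤ B.comap (antipodeAlgHom k H)

lemma IsHopfSubalgebra.sup {B B' : Subalgebra k H} (hB : IsHopfSubalgebra B)
    (hB' : IsHopfSubalgebra B') : IsHopfSubalgebra (B ⊔ B') := by
  refine ⟨sup_le (hB.1.trans ?_) (hB'.1.trans ?_), sup_le (hB.2.trans ?_) (hB'.2.trans ?_)⟩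
  · exact fun _ hx ↦ sup_le_sup (Subalgebra.map_mono le_sup_left)
      (Subalgebra.map_mono le_sup_left) hx
  · exact fun _ hx ↦ sup_le_sup (Subalgebra.map_mono le_sup_right)
      (Subalgebra.map_mono le_sup_right) hx
  · exact fun _ hx ↦ (le_sup_left : B ≤ B ⊔ B') hx
  · exact fun _ hx ↦ (le_sup_right : B' ≤ B ⊔ B') hx

lemma isHopfSubalgebra_bot : IsHopfSubalgebra (⊥ : Subalgebra k H) := ⟨bot_le, bot_le⟩

/-- The subalgebra generated by the entries of a multiplicative matrix and of its inverse is a Hopf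
subalgebra. -/
lemma isHopfSubalgebra_adjoin_matrix {n : ℕ} (a : Matrix (Fin n) (Fin n) H)
    (hΔ : ∀ i j, comul (R := k) (a i j) = ∑ l, a i l ⊗ₜ[k] a l j)
    (hε : ∀ i j, counit (R := k) (a i j) = (1 : Matrix (Fin n) (Fin n) k) i j) :
    IsHopfSubalgebra (Algebra.adjoin k
      ((Set.range fun p : Fin n × Fin n ↦ a p.1 p.2) ∪
        Set.range fun p : Fin n × Fin n ↦ antipode k (a p.1 p.2))) := by
  let S : H →ₐ[k] H := antipodeAlgHom k H
  let D : H →ₐ[k] H ⊗[k] H := Bialgebra.comulAlgHom k H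
  let L : H →ₐ[k] H ⊗[k] H := Algebra.TensorProduct.includeLeft
  let R : H →ₐ[k] H ⊗[k] H := Algebra.TensorProduct.includeRight
  have hSa : S.mapMatrix a * a = 1 := by
    ext i j
    have := mul_antipode_rTensor_comul_apply (R := k) (a i j)
    rw [hΔ, hε] at this
    simpa [Matrix.mul_apply, Matrix.one_apply, S, apply_ite] using this
  have haS : a * S.mapMatrix a = 1 := mul_eq_one_comm.1 hSa
  have hSS : S.mapMatrix (S.mapMatrix a) = a :=
    left_inv_eq_right_inv (by rw [← map_mul, hSa, map_one]) hSa
  have hD : D.mapMatrix a = L.mapMatrix a * R.mapMatrix a := by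
    ext i j
    simp [D, L, R, hΔ, Matrix.mul_apply]
  have hDS : D.mapMatrix (S.mapMatrix a) =
      R.mapMatrix (S.mapMatrix a) * L.mapMatrix (S.mapMatrix a) := by
    refine left_inv_eq_right_inv (a := D.mapMatrix a) (by rw [← map_mul, hSa, map_one]) ?_
    rw [hD, mul_assoc, ← mul_assoc (R.mapMatrix a), ← map_mul, haS, map_one, one_mul, ← map_mul,
      haS, map_one]
  set B := Algebra.adjoin k
      ((Set.range fun p : Fin n × Fin n ↦ a p.1 p.2) ∪
        Set.range fun p : Fin n × Fin n ↦ antipode k (a p.1 p.2))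
  have ha (i j) : a i j ∈ B := Algebra.subset_adjoin (.inl ⟨(i, j), rfl⟩)
  have hS (i j) : S (a i j) ∈ B := Algebra.subset_adjoin (.inr ⟨(i, j), rfl⟩)
  have hL {x} (hx : x ∈ B) : L x ∈ B.map L ⊔ B.map R :=
    (le_sup_left : B.map L ≤ _) ⟨x, hx, rfl⟩
  have hR {x} (hx : x ∈ B) : R x ∈ B.map L ⊔ B.map R :=
    (le_sup_right : B.map R ≤ _) ⟨x, hx, rfl⟩
  refine ⟨Algebra.adjoin_le ?_, Algebra.adjoin_le ?_⟩
  · rintro _ (⟨⟨i, j⟩, rfl⟩ | ⟨⟨i, j⟩, rfl⟩)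
    · change D.mapMatrix a i j ∈ B.map L ⊔ B.map R
      rw [hD, Matrix.mul_apply]
      exact sum_mem fun l _ ↦ mul_mem (hL (ha i l)) (hR (ha l j))
    · change D.mapMatrix (S.mapMatrix a) i j ∈ B.map L ⊔ B.map R
      rw [hDS, Matrix.mul_apply]
      exact sum_mem fun l _ ↦ mul_mem (hR (hS i l)) (hL (hS l j))
  · rintro _ (⟨⟨i, j⟩, rfl⟩ | ⟨⟨i, j⟩, rfl⟩)
    · exact hS i j
    · change S.mapMatrix (S.mapMatrix a) i j ∈ B
      rw [hSS]
      exact ha i j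

lemma exists_fg_isHopfSubalgebra_mem (h : H) :
    ∃ B : Subalgebra k H, B.FG ∧ h ∈ B ∧ IsHopfSubalgebra B := by
  obtain ⟨n, a, hΔ, hε, hmem⟩ := exists_multiplicative_matrix (k := k) h
  refine ⟨_, Subalgebra.fg_def.2 ⟨_, (Set.finite_range _).union (Set.finite_range _), rfl⟩, ?_,
    isHopfSubalgebra_adjoin_matrix a hΔ hε⟩
  exact Algebra.span_le_adjoin k _ (Submodule.span_mono Set.subset_union_left hmem)

lemma exists_fg_isHopfSubalgebra_subset (s : Finset H) :
    ∃ B : Subalgebra k H, B.FG ∧ (s : Set H) ⊆ B ∧ IsHopfSubalgebra B := by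
  classical
  induction s using Finset.induction_on with
  | empty => exact ⟨⊥, Subalgebra.fg_bot, by simp, isHopfSubalgebra_bot⟩
  | insert h s _ ih =>
    obtain ⟨B, hfg, hs, hB⟩ := ih
    obtain ⟨B', hfg', hh, hB'⟩ := exists_fg_isHopfSubalgebra_mem (k := k) h
    refine ⟨B' ⊔ B, hfg'.sup hfg, ?_, hB'.sup hB⟩
    rw [Finset.coe_insert, Set.insert_subset_iff]
    exact ⟨(le_sup_left : B' ≤ _) hh, hs.trans (le_sup_right : B ≤ B' ⊔ B)⟩

end HopfAlgebra

theorem stmt_6 (k : Type u) [Field k] (H : Type u) [CommRing H] [HopfAlgebra k H]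
    (s : Finset H) :
    ∃ B : Subalgebra k H, B.FG ∧ (↑s : Set H) ⊆ (B : Set H) ∧
      (∀ b ∈ B, Coalgebra.comul (R := k) b ∈
        LinearMap.range (TensorProduct.map B.val.toLinearMap B.val.toLinearMap)) ∧
      (∀ b ∈ B, HopfAlgebra.antipode (R := k) b ∈ B) := by
  obtain ⟨B, hfg, hs, hΔ, hS⟩ := exists_fg_isHopfSubalgebra_subset (k := k) s
  refine ⟨B, hfg, hs, fun b hb ↦ ?_, fun b hb ↦ hS hb⟩
  have : B.map Algebra.TensorProduct.includeLeft ⊔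
      B.map (Algebra.TensorProduct.includeRight : H →ₐ[k] H ⊗[k] H) ≤
        (Algebra.TensorProduct.map B.val B.val).range := by
    refine sup_le ?_ ?_
    · rintro _ ⟨x, hx, rfl⟩
      exact ⟨⟨x, hx⟩ ⊗ₜ 1, by simp⟩
    · rintro _ ⟨x, hx, rfl⟩
      exact ⟨1 ⊗ₜ ⟨x, hx⟩, by simp⟩
  exact this (hΔ hb)
end

section
/- Let k be a field and A a finitely generated commutative k-algebra. Then there exists a k-subalgebra π₀(A) of A which is finite-dimensional over k and classically separable over k, and which contains every k-subalgebra of A that is finite-dimensional and classically separable over k; that is, A has a largest separable subalgebra. -/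
/-!
STATEMENT 11: Every finitely generated commutative algebra over a field k has a largest
finite separable subalgebra π₀(A).
-/

open TensorProduct

universe u

/-- A commutative algebra `A` over a field `k` is classically separable if for every field
extension `k ⊆ K` the ring `K ⊗[k] A` has zero Jacobson radical. -/
def ClassicallySeparable (k : Type u) [Field k] (A : Type u) [CommRing A]
    [Algebra k A] : Prop :=
  ∀ (K : Type u) [Field K] [Algebra k K],
    (⊥ : Ideal (K ⊗[k] A)).jacobson = ⊥

section SeparableSubalgebras

open Algebra

/-- A finite reduced algebra over a perfect field is formally unramified. -/
lemma formallyUnramified_of_isReduced (K R : Type*) [Field K] [PerfectField K] [CommRing R]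
    [Algebra K R] [Module.Finite K R] [IsReduced R] : FormallyUnramified K R := by
  have : IsArtinianRing R := .of_finite K R
  let _ (I : MaximalSpectrum R) : Field (R ⧸ I.asIdeal) := Ideal.Quotient.field I.asIdeal
  have (I : MaximalSpectrum R) : FormallyUnramified K (R ⧸ I.asIdeal) :=
    FormallyUnramified.of_isSeparable K (R ⧸ I.asIdeal)
  exact .of_equiv ((IsArtinianRing.equivPi R).restrictScalars K).symm

variable {k : Type u} [Field k] {A : Type u} [CommRing A] [Algebra k A]

lemma ClassicallySeparable.formallyUnramified [FiniteDimensional k A]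
    (h : ClassicallySeparable k A) : FormallyUnramified k A := by
  have : IsReduced (AlgebraicClosure k ⊗[k] A) := by
    rw [← nilradical_eq_bot_iff, ← le_bot_iff, ← h (AlgebraicClosure k),
      Ideal.jacobson_bot]
    exact nilradical_le_jacobson _
  have := formallyUnramified_of_isReduced (AlgebraicClosure k) (AlgebraicClosure k ⊗[k] A)
  exact .of_formallyUnramified_tensorProduct_of_faithfullyFlat (AlgebraicClosure k)

lemma ClassicallySeparable.of_formallyUnramified [FiniteDimensional k A]
    [FormallyUnramified k A] : ClassicallySeparable k A := by
  intro K _ _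
  have : IsArtinianRing (K ⊗[k] A) := .of_finite K _
  have := FormallyUnramified.isReduced_of_field K (K ⊗[k] A)
  rw [Ideal.jacobson_bot, Ring.jacobson_eq_nilradical_of_krullDimLE_zero,
    nilradical_eq_bot_iff]
  infer_instance

lemma formallyUnramified_sup (C D : Subalgebra k A) [FormallyUnramified k C]
    [FormallyUnramified k D] : FormallyUnramified k ↥(C ⊔ D) := by
  have : FormallyUnramified k (C ⊗[k] D) := .comp k C (C ⊗[k] D)
  have h : C ⊔ D = (Algebra.TensorProduct.productMap C.val D.val).range := by
    rw [Algebra.TensorProduct.productMap_range, Subalgebra.range_val, Subalgebra.range_val]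
  rw [h]
  exact .of_surjective _ (AlgHom.rangeRestrict_surjective _)

/-- The dimension of an unramified subalgebra is at most the number of geometric irreducible
components of the ambient algebra. -/
lemma finrank_le_ncard_minimalPrimes [FiniteType k A] (C : Subalgebra k A)
    [FiniteDimensional k C] [FormallyUnramified k C] :
    Module.finrank k C ≤ (minimalPrimes (AlgebraicClosure k ⊗[k] A)).ncard := by
  let K := AlgebraicClosure k
  have : IsNoetherianRing (K ⊗[k] A) := FiniteType.isNoetherianRing K _
  have : IsArtinianRing (K ⊗[k] C) := .of_finite K _
  have : FormallyEtale K (K ⊗[k] C) := .of_formallyUnramified_of_field K _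
  let f : K ⊗[k] C →+* K ⊗[k] A := (Algebra.TensorProduct.map (AlgHom.id K K) C.val).toRingHom
  have hf : Function.Injective f :=
    Module.Flat.lTensor_preserves_injective_linearMap (M := K) C.val.toLinearMap
      Subtype.val_injective
  have hdim : Module.finrank k C = Nat.card (PrimeSpectrum (K ⊗[k] C)) := by
    cases nonempty_fintype (PrimeSpectrum (K ⊗[k] C))
    rw [← Module.finrank_baseChange (R := K),
      (FormallyEtale.equivPiOfIsSepClosed K (K ⊗[k] C)).toLinearEquiv.finrank_eq,
      Module.finrank_fintype_fun_eq_card, Nat.card_eq_fintype_card]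
  have hlift (p : PrimeSpectrum (K ⊗[k] C)) :
      ∃ q : minimalPrimes (K ⊗[k] A), Ideal.comap f q = p.asIdeal := by
    have hp : p.asIdeal ∈ ((⊥ : Ideal (K ⊗[k] A)).comap f).minimalPrimes := by
      rw [← RingHom.ker_eq_comap_bot, (RingHom.injective_iff_ker_eq_bot f).mp hf]
      exact p.asIdeal.mem_minimalPrimes_of_krullDimLE_zero
    obtain ⟨q, hq, h⟩ := Ideal.exists_minimalPrimes_comap_eq f _ hp
    exact ⟨⟨q, hq⟩, h⟩
  choose g hg using hlift
  have : Finite (minimalPrimes (K ⊗[k] A)) := minimalPrimes.finite_of_isNoetherianRing _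
  rw [hdim, ← Nat.card_coe_set_eq]
  refine Nat.card_le_card_of_injective g fun p q h ↦ PrimeSpectrum.ext ?_
  rw [← hg p, ← hg q, h]

end SeparableSubalgebras

theorem stmt_11 (k : Type u) [Field k] (A : Type u) [CommRing A] [Algebra k A]
    [Algebra.FiniteType k A] :
    ∃ B : Subalgebra k A, FiniteDimensional k B ∧ ClassicallySeparable k B ∧
      ∀ C : Subalgebra k A, FiniteDimensional k C → ClassicallySeparable k C → C ≤ B := by
  let S : Set (Subalgebra k A) := {C | FiniteDimensional k C ∧ Algebra.FormallyUnramified k C}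
  let d (C : Subalgebra k A) : ℕ := Module.finrank k C
  have hbot : (⊥ : Subalgebra k A) ∈ S :=
    ⟨inferInstance, .of_surjective (Algebra.ofId k _) fun ⟨x, hx⟩ ↦ by
      obtain ⟨y, rfl⟩ := Algebra.mem_bot.mp hx
      exact ⟨y, rfl⟩⟩
  have hbdd : BddAbove (d '' S) := by
    refine ⟨(minimalPrimes (AlgebraicClosure k ⊗[k] A)).ncard, ?_⟩
    rintro _ ⟨C, ⟨_, _⟩, rfl⟩
    exact finrank_le_ncard_minimalPrimes C
  obtain ⟨B, ⟨hB, hB'⟩, hmax⟩ := Nat.sSup_mem (Set.Nonempty.image d ⟨⊥, hbot⟩) hbdd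
  refine ⟨B, hB, .of_formallyUnramified, fun C hC hC' ↦ ?_⟩
  have := hC'.formallyUnramified
  have hfin : FiniteDimensional k ↥(B ⊔ C) := Subalgebra.finite_sup B C
  have hle : d (B ⊔ C) ≤ d B :=
    hmax ▸ le_csSup hbdd ⟨_, ⟨hfin, formallyUnramified_sup B C⟩, rfl⟩
  have : FiniteDimensional k (Subalgebra.toSubmodule (B ⊔ C)) := hfin
  have heq : Subalgebra.toSubmodule B = Subalgebra.toSubmodule (B ⊔ C) :=
    Submodule.eq_of_le_of_finrank_le (Subalgebra.toSubmodule.monotone le_sup_left) hle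
  exact le_sup_right.trans (Subalgebra.toSubmodule_injective heq).ge
end
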